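/- arXiv:2008.03714 — 6 statements merged into one kernel-verified Lean document; each statement's English description precedes it below -/
import Mathlib

section
/- In the coinductive sequent calculus CLJ over the signature with a constant a, a unary function symbol f and a unary predicate symbol p, every proof of the sequent {∀x. p(f(x)) → p(x)} + ∅ + ∅ ⊢ p(a) contains an instance of the cut rule; equivalently, this sequent has no cut-free CLJ proof. -/
/-!
Cut non-eliminability in the coinductive sequent calculus CLJ, over the
signature with a constant `a`, a unary function symbol `f` and a unary
predicate symbol `p`.  (In this fragment all terms are simple first-order
terms, so convertibility is syntactic equality.)
-/

/-- Terms over the signature `{a, f}`, in locally nameless style: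
`fvar` are free variables, `bvar` are de Bruijn indices bound by quantifiers. -/
inductive Tm : Type
  | fvar : ℕ → Tm
  | bvar : ℕ → Tm
  | a : Tm
  | f : Tm → Tm
  deriving DecidableEq

namespace Tm

/-- Replace the bound variable `k` by the term `u`. -/
def openT (u : Tm) : ℕ → Tm → Tm
  | _, fvar x => fvar x
  | k, bvar n => if n = k then u else bvar n
  | _, a => a
  | k, f t => f (openT u k t)

/-- Free variables of a term. -/
def fv : Tm → Finset ℕ
  | fvar x => {x}
  | bvar _ => ∅
  | a => ∅
  | f t => fv t

/-- Simple first-order terms: no `fix`, no `λ` (none exist in this signature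
anyway) and no dangling bound variable. -/
def Simple : Tm → Prop
  | fvar _ => True
  | bvar _ => False
  | a => True
  | f t => Simple t

end Tm

/-- Formulae over the signature with the unary predicate symbol `p`
(`atom t` is `p(t)`); quantifiers bind de Bruijn indices. -/
inductive Fm : Type
  | atom : Tm → Fm
  | impl : Fm → Fm → Fm
  | conj : Fm → Fm → Fm
  | all : Fm → Fm
  | ex : Fm → Fm
  deriving DecidableEq

namespace Fm

def openF (u : Tm) : ℕ → Fm → Fm
  | k, atom t => atom (Tm.openT u k t)
  | k, impl A B => impl (openF u k A) (openF u k B)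
  | k, conj A B => conj (openF u k A) (openF u k B)
  | k, all A => all (openF u (k + 1) A)
  | k, ex A => ex (openF u (k + 1) A)

/-- Instantiate the outermost binder of a formula with the term `u`. -/
def inst (u : Tm) (A : Fm) : Fm := openF u 0 A

/-- Free variables of a formula. -/
def fv : Fm → Finset ℕ
  | atom t => t.fv
  | impl A B => A.fv ∪ B.fv
  | conj A B => A.fv ∪ B.fv
  | all A => A.fv
  | ex A => A.fv

end Fm

/-- A CLJ sequent `Γ_T + Γ_A + Γ_C ⊢ φ`: a logic-program context, a context of
proof assumptions, a context of coinduction assumptions, and a goal. -/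
structure Sequent where
  T : List Fm
  A : List Fm
  C : List Fm
  goal : Fm

/-- Free variables of a context. -/
def fvCtx (L : List Fm) : Finset ℕ := L.foldr (fun φ s => φ.fv ∪ s) ∅

/-- `s` is the conclusion of an instance of the axiom rule of CLJ: its goal is
(convertible, here: equal, to) a formula of `Γ_T ∪ Γ_A`. -/
def AxiomInst (s : Sequent) : Prop := s.goal ∈ s.T ∨ s.goal ∈ s.A

/-- Instances of all rules of CLJ except the cut rule: `Step ps s` holds iff
there is an instance of a non-cut rule with premises `ps` and conclusion `s`. -/
inductive Step : List Sequent → Sequent → Prop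
  | ax {T A C φ} : φ ∈ T ∨ φ ∈ A → Step [] ⟨T, A, C, φ⟩
  | conjR {T A C φ₁ φ₂} :
      Step [⟨T, A, C, φ₁⟩, ⟨T, A, C, φ₂⟩] ⟨T, A, C, .conj φ₁ φ₂⟩
  | conjLT {T A C φ ψ ψ₁ ψ₂} : ψ = ψ₁ ∨ ψ = ψ₂ →
      Step [⟨ψ :: T, A, C, φ⟩] ⟨.conj ψ₁ ψ₂ :: T, A, C, φ⟩
  | conjLA {T A C φ ψ ψ₁ ψ₂} : ψ = ψ₁ ∨ ψ = ψ₂ →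
      Step [⟨T, ψ :: A, C, φ⟩] ⟨T, .conj ψ₁ ψ₂ :: A, C, φ⟩
  | allR {T A C φ} (x : ℕ) :
      x ∉ fvCtx T ∪ fvCtx A ∪ fvCtx C ∪ (Fm.all φ).fv →
      Step [⟨T, A, C, φ.inst (.fvar x)⟩] ⟨T, A, C, .all φ⟩
  | exR {T A C φ} (N : Tm) : N.Simple →
      Step [⟨T, A, C, φ.inst N⟩] ⟨T, A, C, .ex φ⟩
  | allLT {T A C φ ψ} (N : Tm) : N.Simple →
      Step [⟨ψ.inst N :: T, A, C, φ⟩] ⟨.all ψ :: T, A, C, φ⟩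
  | allLA {T A C φ ψ} (N : Tm) : N.Simple →
      Step [⟨T, ψ.inst N :: A, C, φ⟩] ⟨T, .all ψ :: A, C, φ⟩
  | implR {T A C ψ φ} :
      Step [⟨T, ψ :: A, C, φ⟩] ⟨T, A, C, .impl ψ φ⟩
  | implLT {T A C φ ξ ψ} :
      Step [⟨ψ :: T, A, C, φ⟩, ⟨T, A ++ C, [], ξ⟩] ⟨.impl ξ ψ :: T, A, C, φ⟩
  | implLA {T A C φ ξ ψ} :
      Step [⟨T, ψ :: A, C, φ⟩, ⟨T, A, C, ξ⟩] ⟨T, .impl ξ ψ :: A, C, φ⟩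
  | cofix {T A C φ} :
      Step [⟨T, A, φ :: C, φ⟩] ⟨T, A, C, φ⟩
  | weakT {T A C φ ψ} : Step [⟨T, A, C, φ⟩] ⟨ψ :: T, A, C, φ⟩
  | weakA {T A C φ ψ} : Step [⟨T, A, C, φ⟩] ⟨T, ψ :: A, C, φ⟩
  | exchT {T₁ T₂ A C φ χ ψ} :
      Step [⟨T₁ ++ χ :: ψ :: T₂, A, C, φ⟩] ⟨T₁ ++ ψ :: χ :: T₂, A, C, φ⟩
  | exchA {T A₁ A₂ C φ χ ψ} :
      Step [⟨T, A₁ ++ χ :: ψ :: A₂, C, φ⟩] ⟨T, A₁ ++ ψ :: χ :: A₂, C, φ⟩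
  | contrT {T A C φ ψ} : Step [⟨ψ :: ψ :: T, A, C, φ⟩] ⟨ψ :: T, A, C, φ⟩
  | contrA {T A C φ ψ} : Step [⟨T, ψ :: ψ :: A, C, φ⟩] ⟨T, ψ :: A, C, φ⟩

/-- Cut-free CLJ provability: finite derivation trees built from the
non-cut rules only. -/
inductive CutFree : Sequent → Prop
  | step {ps s} : Step ps s → (∀ q ∈ ps, CutFree q) → CutFree s

/-- CLJ provability: finite derivation trees that may also use the cut rule. -/
inductive Proves : Sequent → Prop
  | step {ps s} : Step ps s → (∀ q ∈ ps, Proves q) → Proves s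
  | cut {T A C ψ φ} : Proves ⟨T, A, C, ψ⟩ → Proves ⟨T, ψ :: A, C, φ⟩ →
      Proves ⟨T, A, C, φ⟩

/-- The Horn clause `∀x. p(f(x)) → p(x)`. -/
def clauseP : Fm := .all (.impl (.atom (.f (.bvar 0))) (.atom (.bvar 0)))

/-- The formulae that arise from `clauseP` by decomposition: the clause itself, its instances
`p(f(s)) → p(s)`, and atoms. -/
inductive ClauseDerived : Fm → Prop
  | clause : ClauseDerived clauseP
  | inst (s : Tm) : ClauseDerived (.impl (.atom (.f s)) (.atom s))
  | atom (s : Tm) : ClauseDerived (.atom s)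

/-- Some atom `p(f^k(t))` is available: among the program clauses or proof assumptions, or,
for `k ≥ 1`, among the coinduction assumptions. -/
def Supported (s : Sequent) (t : Tm) : Prop :=
  ∃ k, .atom (Tm.f^[k] t) ∈ s.T ∨ .atom (Tm.f^[k] t) ∈ s.A ∨
    (0 < k ∧ .atom (Tm.f^[k] t) ∈ s.C)

/-- All assumptions of a sequent are atoms, and its program clauses stem from `clauseP`. -/
structure Admissible (s : Sequent) : Prop where
  T : ∀ φ ∈ s.T, ClauseDerived φ
  A : ∀ φ ∈ s.A, ∃ t, φ = .atom t
  C : ∀ φ ∈ s.C, ∃ t, φ = .atom t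

theorem CutFree.supported {s : Sequent} (h : CutFree s) :
    Admissible s → ∀ t, s.goal = .atom t → Supported s t := by
  induction h with
  | step hs _ ih =>
    rintro ⟨hT, hA, hC⟩ t ht
    cases hs with
    | ax h =>
      simp only at ht
      subst ht
      exact ⟨0, h.imp_right Or.inl⟩
    | conjR => cases ht
    | allR => cases ht
    | exR => cases ht
    | implR => cases ht
    | conjLT => cases hT _ List.mem_cons_self
    | conjLA => obtain ⟨_, h⟩ := hA _ List.mem_cons_self; cases h
    | allLA => obtain ⟨_, h⟩ := hA _ List.mem_cons_self; cases h
    | implLA => obtain ⟨_, h⟩ := hA _ List.mem_cons_self; cases h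
    | allLT N =>
      simp only [List.mem_cons, forall_eq_or_imp] at hT
      obtain ⟨hψ, hT⟩ := hT
      cases hψ
      obtain ⟨k, hk⟩ := ih _ (List.mem_singleton.2 rfl)
        ⟨by simpa [Fm.inst, Fm.openF, Tm.openT] using ⟨ClauseDerived.inst N, hT⟩, hA, hC⟩
        t ht
      exact ⟨k, by simpa [Fm.inst, Fm.openF] using hk⟩
    | implLT =>
      simp only [List.mem_cons, forall_eq_or_imp] at hT
      obtain ⟨hψ, hT⟩ := hT
      cases hψ with
      | inst s =>
      obtain ⟨k, hk⟩ := ih _ List.mem_cons_self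
        ⟨by simpa using ⟨ClauseDerived.atom s, hT⟩, hA, hC⟩ t ht
      obtain ⟨m, hm⟩ := ih _ (List.mem_cons_of_mem _ List.mem_cons_self)
        ⟨hT, by simpa [or_imp, forall_and] using ⟨hA, hC⟩, by simp⟩ (.f s) rfl
      simp only [List.mem_cons, List.mem_append, Fm.atom.injEq,
        List.not_mem_nil, and_false, or_false] at hk hm
      rcases hk with (hk | hk) | hk
      · subst hk
        rw [← Function.iterate_succ_apply' Tm.f, ← Function.iterate_add_apply] at hm
        exact ⟨m + (k + 1), by simpa using hm⟩
      · exact ⟨k, .inl (by simpa using hk)⟩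
      · exact ⟨k, .inr hk⟩
    | cofix =>
      simp only at ht
      subst ht
      obtain ⟨k, hk⟩ := ih _ (List.mem_singleton.2 rfl)
        ⟨hT, hA, by simpa using hC⟩ t rfl
      simp only [List.mem_cons, Fm.atom.injEq] at hk
      rcases hk with hk | hk | ⟨hpos, hk | hk⟩
      · exact ⟨k, .inl hk⟩
      · exact ⟨k, .inr (.inl hk)⟩
      · have hsize := congrArg sizeOf hk
        have hgrow : ∀ n, sizeOf (Tm.f^[n] t) = n + sizeOf t := by
          intro n
          induction n with
          | zero => simp
          | succ n ihn => rw [Function.iterate_succ_apply']; simp [ihn]; omega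
        rw [hgrow] at hsize
        omega
      · exact ⟨k, .inr (.inr ⟨hpos, hk⟩)⟩
    | weakT =>
      obtain ⟨k, hk⟩ := ih _ (List.mem_singleton.2 rfl)
        ⟨fun φ h => hT φ (List.mem_cons_of_mem _ h), hA, hC⟩ t ht
      exact ⟨k, hk.imp_left (List.mem_cons_of_mem _)⟩
    | weakA =>
      obtain ⟨k, hk⟩ := ih _ (List.mem_singleton.2 rfl)
        ⟨hT, fun φ h => hA φ (List.mem_cons_of_mem _ h), hC⟩ t ht
      exact ⟨k, hk.imp_right (Or.imp_left (List.mem_cons_of_mem _))⟩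
    | exchT =>
      obtain ⟨k, hk⟩ := ih _ (List.mem_singleton.2 rfl)
        ⟨fun φ h => hT φ (by simp at h ⊢; tauto), hA, hC⟩ t ht
      exact ⟨k, hk.imp_left (by simp; tauto)⟩
    | exchA =>
      obtain ⟨k, hk⟩ := ih _ (List.mem_singleton.2 rfl)
        ⟨hT, fun φ h => hA φ (by simp at h ⊢; tauto), hC⟩ t ht
      exact ⟨k, hk.imp_right (Or.imp_left (by simp; tauto))⟩
    | contrT =>
      obtain ⟨k, hk⟩ := ih _ (List.mem_singleton.2 rfl)
        ⟨fun φ h => hT φ (by simpa using h), hA, hC⟩ t ht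
      exact ⟨k, hk.imp_left (by simp)⟩
    | contrA =>
      obtain ⟨k, hk⟩ := ih _ (List.mem_singleton.2 rfl)
        ⟨hT, fun φ h => hA φ (by simpa using h), hC⟩ t ht
      exact ⟨k, hk.imp_right (Or.imp_left (by simp))⟩

/-- **Cut is not eliminable in CLJ**: the sequent
`{∀x. p(f(x)) → p(x)} + ∅ + ∅ ⊢ p(a)` has no cut-free CLJ proof, i.e. every
CLJ proof of it contains an instance of the cut rule. -/
theorem cut_not_eliminable_in_CLJ :
    ¬ CutFree ⟨[clauseP], [], [], .atom .a⟩ := by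
  intro h
  obtain ⟨k, hk⟩ := h.supported ⟨by simpa using ClauseDerived.clause, by simp, by simp⟩ .a rfl
  simp [clauseP] at hk
end

section
/- For every instance of any rule of CLJ other than the cut rule whose conclusion belongs to the set S of bad sequents, at least one premise of that instance also belongs to S. -/
/-- `f` applied `i` times to a term. -/
def fpow : ℕ → Tm → Tm
  | 0, t => t
  | n + 1, t => .f (fpow n t)

/-- The set `S` of *bad sequents*: sequents `Γ_T + Γ_A + Γ_C ⊢ p(N)` with `N` a
simple first-order term, such that
`Γ_T ⊆ {p(t) : t simple, t ≠ fⁱ(N) for all i ≥ 0} ∪ {∀x. p(f(x)) → p(x)} ∪ {p(f(t)) → p(t) : t simple}`,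
`Γ_A ⊆ {p(t) : t simple, t ≠ fⁱ(N) for all i ≥ 0}`, and
`Γ_C ⊆ {p(t) : t simple, t ≠ fⁱ(N) for all i > 0}`. -/
def Bad (s : Sequent) : Prop :=
  ∃ N : Tm, N.Simple ∧ s.goal = .atom N ∧
    (∀ φ ∈ s.T, φ = clauseP ∨
        (∃ t : Tm, t.Simple ∧ φ = .impl (.atom (.f t)) (.atom t)) ∨
        (∃ t : Tm, t.Simple ∧ φ = .atom t ∧ ∀ i : ℕ, t ≠ fpow i N)) ∧
    (∀ φ ∈ s.A, ∃ t : Tm, t.Simple ∧ φ = .atom t ∧ ∀ i : ℕ, t ≠ fpow i N) ∧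
    (∀ φ ∈ s.C, ∃ t : Tm, t.Simple ∧ φ = .atom t ∧ ∀ i : ℕ, 0 < i → t ≠ fpow i N)

theorem fpow_fpow (i j : ℕ) (t : Tm) : fpow i (fpow j t) = fpow (i + j) t := by
  induction i with
  | zero => rw [fpow, Nat.zero_add]
  | succ i ih => rw [fpow, ih, Nat.succ_add, fpow]

theorem Tm.Simple.fpow {t : Tm} (h : t.Simple) (i : ℕ) : (fpow i t).Simple := by
  induction i with
  | zero => exact h
  | succ i ih => exact ih

theorem sizeOf_fpow (i : ℕ) (t : Tm) : sizeOf (fpow i t) = i + sizeOf t := by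
  induction i with
  | zero => simp [fpow]
  | succ i ih => simp [fpow, ih]; omega

theorem ne_fpow_self {i : ℕ} (hi : 0 < i) (t : Tm) : t ≠ fpow i t := by
  intro h
  have := congrArg sizeOf h
  rw [sizeOf_fpow] at this
  omega

/-- For every instance of a CLJ rule other than cut whose conclusion is a bad
sequent, at least one premise of the instance is a bad sequent. -/
theorem bad_sequent_premise (ps : List Sequent) (s : Sequent)
    (hstep : Step ps s) (hs : Bad s) : ∃ q ∈ ps, Bad q := by
  obtain ⟨N, hN, hg, hT, hA, hC⟩ := hs
  cases hstep with
  | ax h =>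
    simp only at hg hT hA
    subst hg
    rcases h with h | h
    · rcases hT _ h with h | ⟨t, _, h⟩ | ⟨t, _, h, ht⟩
      · cases h
      · cases h
      · cases h
        exact absurd rfl (ht 0)
    · obtain ⟨t, _, h, ht⟩ := hA _ h
      cases h
      exact absurd rfl (ht 0)
  | conjR => cases hg
  | conjLT _ =>
    rcases hT _ List.mem_cons_self with h | ⟨t, _, h⟩ | ⟨t, _, h, _⟩ <;> cases h
  | conjLA _ =>
    obtain ⟨t, _, h, _⟩ := hA _ List.mem_cons_self
    cases h
  | allR => cases hg
  | exR => cases hg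
  | allLT M hM =>
    refine ⟨_, List.mem_singleton_self _, N, hN, hg, ?_, hA, hC⟩
    obtain ⟨h, hTail⟩ := List.forall_mem_cons.mp hT
    refine List.forall_mem_cons.mpr ⟨.inr (.inl ⟨M, hM, ?_⟩), hTail⟩
    rcases h with h | ⟨t, _, h⟩ | ⟨t, _, h, _⟩
    · cases h
      rfl
    · cases h
    · cases h
  | allLA =>
    obtain ⟨t, _, h, _⟩ := hA _ List.mem_cons_self
    cases h
  | implR => cases hg
  | implLT =>
    obtain ⟨h, hTail⟩ := List.forall_mem_cons.mp hT
    rcases h with h | ⟨t, ht, h⟩ | ⟨t, _, h, _⟩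
    · cases h
    · cases h
      by_cases hi : ∃ i, t = fpow i N
      · obtain ⟨i, rfl⟩ := hi
        refine ⟨_, List.mem_cons_of_mem _ (List.mem_singleton_self _),
          fpow (i + 1) N, hN.fpow _, rfl, ?_, ?_, List.forall_mem_nil _⟩
        · intro φ hφ
          refine (hTail φ hφ).imp_right (Or.imp_right ?_)
          rintro ⟨t, ht, h, hne⟩
          exact ⟨t, ht, h, fun j => fpow_fpow j (i + 1) N ▸ hne _⟩
        · intro φ hφ
          rcases List.mem_append.mp hφ with hφ | hφ
          · obtain ⟨t, ht, h, hne⟩ := hA φ hφ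
            exact ⟨t, ht, h, fun j => fpow_fpow j (i + 1) N ▸ hne _⟩
          · obtain ⟨t, ht, h, hne⟩ := hC φ hφ
            exact ⟨t, ht, h, fun j => fpow_fpow j (i + 1) N ▸ hne _ (by omega)⟩
      · exact ⟨_, List.mem_cons_self, N, hN, hg, List.forall_mem_cons.mpr
          ⟨.inr (.inr ⟨t, ht, rfl, not_exists.mp hi⟩), hTail⟩, hA, hC⟩
    · cases h
  | implLA =>
    obtain ⟨t, _, h, _⟩ := hA _ List.mem_cons_self
    cases h
  | cofix =>
    exact ⟨_, List.mem_singleton_self _, N, hN, hg, hT, hA, List.forall_mem_cons.mpr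
      ⟨⟨N, hN, hg, fun _ hi => ne_fpow_self hi N⟩, hC⟩⟩
  | weakT =>
    exact ⟨_, List.mem_singleton_self _, N, hN, hg, (List.forall_mem_cons.mp hT).2, hA, hC⟩
  | weakA =>
    exact ⟨_, List.mem_singleton_self _, N, hN, hg, hT, (List.forall_mem_cons.mp hA).2, hC⟩
  | exchT =>
    exact ⟨_, List.mem_singleton_self _, N, hN, hg,
      fun φ hφ => hT φ (((List.Perm.swap _ _ _).append_left _).mem_iff.mp hφ), hA, hC⟩
  | exchA =>
    exact ⟨_, List.mem_singleton_self _, N, hN, hg, hT,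
      fun φ hφ => hA φ (((List.Perm.swap _ _ _).append_left _).mem_iff.mp hφ), hC⟩
  | contrT =>
    exact ⟨_, List.mem_singleton_self _, N, hN, hg,
      List.forall_mem_cons.mpr ⟨hT _ List.mem_cons_self, hT⟩, hA, hC⟩
  | contrA =>
    exact ⟨_, List.mem_singleton_self _, N, hN, hg, hT,
      List.forall_mem_cons.mpr ⟨hA _ List.mem_cons_self, hA⟩, hC⟩
end

section
/- Over the signature with constant a, unary function symbol f and unary predicate symbol p, the sequent {∀x. p(f(x)) → p(x)} + ∅ + ∅ ⊢ ∀x. p(x) has a cut-free CLJ proof (obtained by applying the cofix rule with coinduction hypothesis ∀x. p(x)). -/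
/-- The sequent `{∀x. p(f(x)) → p(x)} + ∅ + ∅ ⊢ ∀x. p(x)` has a cut-free CLJ
proof (obtained by the cofix rule with coinduction hypothesis `∀x. p(x)`). -/
theorem cutfree_proof_of_all_p :
    CutFree ⟨[clauseP], [], [], .all (.atom (.bvar 0))⟩ := by
  have coinductive_call : CutFree
      ⟨[], [.all (.atom (.bvar 0))], [], .atom (.f (.fvar 0))⟩ := by
    refine .step (.allLA (.f (.fvar 0)) trivial) ?_
    rintro q (_ | ⟨_, ⟨⟩⟩)
    exact .step (.ax (.inr (.head _))) nofun
  refine .step .cofix ?_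
  rintro q (_ | ⟨_, ⟨⟩⟩)
  refine .step (.allR 0 (by simp [fvCtx, clauseP, Fm.fv, Tm.fv])) ?_
  rintro q (_ | ⟨_, ⟨⟩⟩)
  refine .step (.allLT (.fvar 0) trivial) ?_
  rintro q (_ | ⟨_, ⟨⟩⟩)
  refine .step .implLT ?_
  rintro q (_ | ⟨_, _ | ⟨_, ⟨⟩⟩⟩)
  · exact .step (.ax (.inl (.head _))) nofun
  · exact coinductive_call
end

section
/- Over the signature with constant a, unary function symbol f and unary predicate symbol p, the sequent {∀x. p(f(x)) → p(x)} + ∅ + ∅ ⊢ p(a) is provable in CLJ (using the cut rule with cut formula ∀x. p(x)). -/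
/-- Apply a non-cut rule without premises. -/
theorem Proves.of_step_nil {s : Sequent} (h : Step [] s) : Proves s :=
  .step h (by simp)

/-- Apply a non-cut rule with one premise. -/
theorem Proves.of_step {q s : Sequent} (h : Step [q] s) (hq : Proves q) : Proves s :=
  .step h (by simpa using hq)

/-- Apply a non-cut rule with two premises. -/
theorem Proves.of_step_pair {q r s : Sequent} (h : Step [q, r] s)
    (hq : Proves q) (hr : Proves r) : Proves s :=
  .step h (by simpa using ⟨hq, hr⟩)

/-- The sequent `{∀x. p(f(x)) → p(x)} + ∅ + ∅ ⊢ ∀x. p(x)` is provable by coinduction on its goal. -/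
theorem forall_atom_of_clauseP :
    Proves ⟨[clauseP], [], [], .all (.atom (.bvar 0))⟩ := by
  refine .of_step .cofix (.of_step (.allR 0 ?_) (.of_step (.allLT (.fvar 0) trivial)
    (.of_step_pair .implLT (.of_step_nil (.ax ?_))
      (.of_step (.allLA (.f (.fvar 0)) trivial) (.of_step_nil (.ax ?_))))))
  · simp [fvCtx, clauseP, Fm.fv, Tm.fv]
  · simp [Fm.inst, Fm.openF, Tm.openT]
  · simp [Fm.inst, Fm.openF, Tm.openT]

/-- The sequent `{∀x. p(f(x)) → p(x)} + ∅ + ∅ ⊢ p(a)` is provable in CLJ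
(using the cut rule, with cut formula `∀x. p(x)`). -/
theorem CLJ_proves_p_a : Proves ⟨[clauseP], [], [], .atom .a⟩ := by
  refine .cut forall_atom_of_clauseP (.of_step (.allLA .a trivial) (.of_step_nil (.ax ?_)))
  simp [Fm.inst, Fm.openF, Tm.openT]
end

section
/- Let {x₁ = t₁, …, xₙ = tₙ} be a linear unifying set of equations over simple first-order terms, and let δ₀, δ₁, …, δₙ be the sequence of fix-substitutions from the circular-unifier construction. Then for every k ≤ n, the fix-substitution δₖ unifies the first k equations up to convertibility: xᵢ[δₖ] ≅ tᵢ[δₖ] for all i ≤ k. -/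
/-!
Guarded first-order fixpoint terms over a first-order signature, convertibility
(the equivalence closure of fix-reduction; there is no `λ` in first-order
terms, so β-reduction is vacuous), fix-substitutions, unifying equations and
the circular-unifier construction.

The signature is given by a type `F` of function symbols together with an
arity function `ar : F → ℕ`.  Terms are in locally nameless style: `fvar`
are (named) free variables, `bvar` are de Bruijn indices bound by `fix`.
-/

/-- First-order fixpoint terms over the signature `(F, ar)`. -/
inductive GTm (F : Type) (ar : F → ℕ) : Type
  | fvar : ℕ → GTm F ar
  | bvar : ℕ → GTm F ar
  | app : (f : F) → (Fin (ar f) → GTm F ar) → GTm F ar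
  | fix : GTm F ar → GTm F ar

namespace GTm

variable {F : Type} {ar : F → ℕ}

/-- Replace the bound variable `k` by the term `u`. -/
def openT (u : GTm F ar) : ℕ → GTm F ar → GTm F ar
  | _, fvar x => fvar x
  | k, bvar n => if n = k then u else bvar n
  | k, app f ts => app f fun i => openT u k (ts i)
  | k, fix t => fix (openT u (k + 1) t)

/-- Apply a fix-substitution (a map from free variables to terms);
this is capture-avoiding since bound variables are de Bruijn indices. -/
def subst (σ : ℕ → GTm F ar) : GTm F ar → GTm F ar
  | fvar x => σ x
  | bvar n => bvar n
  | app f ts => app f fun i => subst σ (ts i)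
  | fix t => fix (subst σ t)

/-- `x` occurs free in the term. -/
def HasFVar (x : ℕ) : GTm F ar → Prop
  | fvar y => y = x
  | bvar _ => False
  | app _ ts => ∃ i, HasFVar x (ts i)
  | fix t => HasFVar x t

/-- Abstract the free variable `x` to the bound variable `k`. -/
def abstractT (x : ℕ) : ℕ → GTm F ar → GTm F ar
  | k, fvar y => if y = x then bvar k else fvar y
  | _, bvar n => bvar n
  | k, app f ts => app f fun i => abstractT x k (ts i)
  | k, fix t => fix (abstractT x (k + 1) t)

/-- `fix x. t`, binding the named free variable `x` of `t`. -/
def mkFix (x : ℕ) (t : GTm F ar) : GTm F ar := fix (abstractT x 0 t)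

/-- Simple first-order terms: terms built from function symbols and variables
only, with no `fix` (hence also no dangling de Bruijn index). -/
def Simple : GTm F ar → Prop
  | fvar _ => True
  | bvar _ => False
  | app _ ts => ∀ i, Simple (ts i)
  | fix _ => False

end GTm

/-- Convertibility `≅`: the equivalence and congruence closure of
fix-reduction `fix x. M ⇝ M[fix x. M / x]` (β-reduction is vacuous for
first-order terms, which contain no `λ`). -/
inductive Conv {F : Type} {ar : F → ℕ} : GTm F ar → GTm F ar → Prop
  | refl (t : GTm F ar) : Conv t t
  | symm {t u} : Conv t u → Conv u t
  | trans {t u v} : Conv t u → Conv u v → Conv t v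
  | app {f : F} {ts us : Fin (ar f) → GTm F ar} :
      (∀ i, Conv (ts i) (us i)) → Conv (.app f ts) (.app f us)
  | fix {t u} : Conv t u → Conv (.fix t) (.fix u)
  | unfold (t : GTm F ar) : Conv (.fix t) (GTm.openT (.fix t) 0 t)

variable {F : Type} {ar : F → ℕ}

/-- The identity substitution. -/
def idS : ℕ → GTm F ar := .fvar

/-- The single substitution `[u / x]`. -/
def single (x : ℕ) (u : GTm F ar) : ℕ → GTm F ar :=
  fun y => if y = x then u else .fvar y

/-- Composition of substitutions: `(σ₁ ∘ σ₂)(x) = σ₂(x)[σ₁]`. -/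
def compS (σ₁ σ₂ : ℕ → GTm F ar) : ℕ → GTm F ar := fun x => GTm.subst σ₁ (σ₂ x)

open Classical in
/-- One step `δᵢ ↦ δ_{i+1}` of the circular-unifier construction, for the
equation `e = (x_{i+1}, t_{i+1})`:
if `t_{i+1}[δᵢ] = x_{i+1}` then `δᵢ`; otherwise, if `x_{i+1}` does not occur
free in `t_{i+1}[δᵢ]` then `[t_{i+1}[δᵢ] / x_{i+1}] ∘ δᵢ`; and otherwise
`[fix x_{i+1}. t_{i+1}[δᵢ] / x_{i+1}] ∘ δᵢ`. -/
noncomputable def circStep (δ : ℕ → GTm F ar) (e : ℕ × GTm F ar) : ℕ → GTm F ar :=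
  let t' := GTm.subst δ e.2
  if t' = .fvar e.1 then δ
  else if GTm.HasFVar e.1 t' then compS (single e.1 (GTm.mkFix e.1 t')) δ
  else compS (single e.1 t') δ

/-- The circular unifier `δₙ` obtained from the list of unifying equations
`[(x₁, t₁), …, (xₙ, tₙ)]`, starting with `δ₀ = id`. -/
noncomputable def circUnifier (es : List (ℕ × GTm F ar)) : ℕ → GTm F ar :=
  es.foldl circStep idS

/-- The set of unifying equations of two (simple first-order) terms:
`e ∈ U_{t,u}` iff `UEq t u e`.  If `t` is a variable `x` then
`U_{t,u} = {x = u}`; else if `u` is a variable `x` then `U_{t,u} = {x = t}`;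
else if `t = f(t₁,…,tₙ)` and `u = f(u₁,…,uₙ)` have the same head then
`U_{t,u} = ⋃ₖ U_{tₖ,uₖ}`; otherwise `U_{t,u} = ∅`. -/
inductive UEq {F : Type} {ar : F → ℕ} : GTm F ar → GTm F ar → ℕ × GTm F ar → Prop
  | varL (x : ℕ) (u : GTm F ar) : UEq (.fvar x) u (x, u)
  | varR (f : F) (ts : Fin (ar f) → GTm F ar) (x : ℕ) :
      UEq (.app f ts) (.fvar x) (x, .app f ts)
  | app {f : F} {ts us : Fin (ar f) → GTm F ar} {e} (i : Fin (ar f)) :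
      UEq (ts i) (us i) e → UEq (.app f ts) (.app f us) e

namespace GTm

variable {F : Type} {ar : F → ℕ}

/-- All dangling de Bruijn indices of the term are smaller than `k`. -/
def ClosedAt : ℕ → GTm F ar → Prop
  | _, fvar _ => True
  | k, bvar n => n < k
  | k, app _ ts => ∀ i, ClosedAt k (ts i)
  | k, fix t => ClosedAt (k + 1) t

theorem ClosedAt.mono {t : GTm F ar} {k l : ℕ} (h : t.ClosedAt k) (hkl : k ≤ l) :
    t.ClosedAt l := by
  induction t generalizing k l with
  | fvar x => trivial
  | bvar n => exact lt_of_lt_of_le h hkl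
  | app f ts ih => exact fun i => ih i (h i) hkl
  | fix t ih => exact ih (k := k + 1) (l := l + 1) h (Nat.succ_le_succ hkl)

theorem Simple.closedAt {t : GTm F ar} (h : t.Simple) (k : ℕ) : t.ClosedAt k := by
  induction t with
  | fvar x => trivial
  | bvar n => exact h.elim
  | app f ts ih => exact fun i => ih i (h i)
  | fix t ih => exact h.elim

theorem openT_eq_self {t : GTm F ar} {k : ℕ} (h : t.ClosedAt k) (u : GTm F ar) :
    openT u k t = t := by
  induction t generalizing k with
  | fvar x => rfl
  | bvar n => exact if_neg (Nat.ne_of_lt h)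
  | app f ts ih => exact congrArg (app f) (funext fun i => ih i (h i))
  | fix t ih => exact congrArg fix (ih (k := k + 1) h)

theorem ClosedAt.subst {t : GTm F ar} {k : ℕ} (h : t.ClosedAt k) {σ : ℕ → GTm F ar}
    (hσ : ∀ x, (σ x).ClosedAt 0) : (t.subst σ).ClosedAt k := by
  induction t generalizing k with
  | fvar x => exact (hσ x).mono (Nat.zero_le k)
  | bvar n => exact h
  | app f ts ih => exact fun i => ih i (h i)
  | fix t ih => exact ih (k := k + 1) h

theorem ClosedAt.abstractT {t : GTm F ar} {k : ℕ} (h : t.ClosedAt k) (x : ℕ) :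
    (t.abstractT x k).ClosedAt (k + 1) := by
  induction t generalizing k with
  | fvar y =>
    by_cases hy : y = x <;> simp [GTm.abstractT, hy, ClosedAt]
  | bvar n => exact Nat.lt_succ_of_lt h
  | app f ts ih => exact fun i => ih i (h i)
  | fix t ih => exact ih (k := k + 1) h

theorem ClosedAt.mkFix {t : GTm F ar} (h : t.ClosedAt 0) (x : ℕ) :
    (t.mkFix x).ClosedAt 0 :=
  h.abstractT x

theorem subst_openT {σ : ℕ → GTm F ar} (hσ : ∀ x, (σ x).ClosedAt 0) (u t : GTm F ar) (k : ℕ) :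
    (openT u k t).subst σ = openT (u.subst σ) k (t.subst σ) := by
  induction t generalizing k with
  | fvar x => exact (openT_eq_self ((hσ x).mono (Nat.zero_le k)) _).symm
  | bvar n => by_cases hn : n = k <;> simp [openT, subst, hn]
  | app f ts ih => exact congrArg (app f) (funext fun i => ih i k)
  | fix t ih => exact congrArg fix (ih (k + 1))

theorem subst_compS (σ τ : ℕ → GTm F ar) (t : GTm F ar) :
    t.subst (compS σ τ) = (t.subst τ).subst σ := by
  induction t with
  | fvar x => rfl
  | bvar n => rfl
  | app f ts ih => exact congrArg (app f) (funext ih)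
  | fix t ih => exact congrArg fix ih

theorem subst_single_of_not_hasFVar {x : ℕ} {t : GTm F ar} (h : ¬ t.HasFVar x)
    (u : GTm F ar) : t.subst (single x u) = t := by
  induction t with
  | fvar y => exact if_neg h
  | bvar n => rfl
  | app f ts ih => exact congrArg (app f) (funext fun i => ih i fun hi => h ⟨i, hi⟩)
  | fix t ih => exact congrArg fix (ih h)

theorem openT_abstractT {t : GTm F ar} {k : ℕ} (h : t.ClosedAt k) (x : ℕ) (u : GTm F ar) :
    openT u k (abstractT x k t) = t.subst (single x u) := by
  induction t generalizing k with
  | fvar y => by_cases hy : y = x <;> simp [abstractT, openT, subst, single, hy]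
  | bvar n => exact if_neg (Nat.ne_of_lt h)
  | app f ts ih => exact congrArg (app f) (funext fun i => ih i (h i))
  | fix t ih => exact congrArg fix (ih (k := k + 1) h)

end GTm

theorem Conv.subst {t u : GTm F ar} (h : Conv t u) {σ : ℕ → GTm F ar}
    (hσ : ∀ x, (σ x).ClosedAt 0) : Conv (t.subst σ) (u.subst σ) := by
  induction h with
  | refl t => exact .refl _
  | symm _ ih => exact ih.symm
  | trans _ _ ih₁ ih₂ => exact ih₁.trans ih₂
  | app _ ih => exact .app ih
  | fix _ ih => exact .fix ih
  | unfold t =>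
    rw [GTm.subst_openT hσ]
    exact .unfold _

theorem conv_mkFix {t : GTm F ar} (h : t.ClosedAt 0) (x : ℕ) :
    Conv (t.mkFix x) (t.subst (single x (t.mkFix x))) := by
  rw [← GTm.openT_abstractT h]
  exact .unfold _

theorem closedAt_single {u : GTm F ar} (h : u.ClosedAt 0) (x y : ℕ) :
    (single x u y).ClosedAt 0 := by
  unfold single
  split_ifs
  · exact h
  · trivial

/-- A step of the construction is either trivial or a composition with a single
substitution that solves the new equation. -/
theorem circStep_cases (δ : ℕ → GTm F ar) (e : ℕ × GTm F ar)
    (ht : (e.2.subst δ).ClosedAt 0) :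
    (e.2.subst δ = .fvar e.1 ∧ circStep δ e = δ) ∨
      ∃ u : GTm F ar, u.ClosedAt 0 ∧ circStep δ e = compS (single e.1 u) δ ∧
        Conv u ((e.2.subst δ).subst (single e.1 u)) := by
  by_cases h₁ : e.2.subst δ = .fvar e.1
  · exact .inl ⟨h₁, by simp [circStep, h₁]⟩
  · right
    by_cases h₂ : (e.2.subst δ).HasFVar e.1
    · exact ⟨_, ht.mkFix e.1, by simp [circStep, h₁, h₂], conv_mkFix ht e.1⟩
    · refine ⟨_, ht, by simp [circStep, h₁, h₂], ?_⟩
      rw [GTm.subst_single_of_not_hasFVar h₂]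
      exact .refl _

theorem circUnifier_spec (es : List (ℕ × GTm F ar))
    (hsimple : ∀ e ∈ es, GTm.Simple e.2) (hlin : (es.map Prod.fst).Nodup) :
    (∀ x, (circUnifier es x).ClosedAt 0) ∧
      (∀ x ∉ es.map Prod.fst, circUnifier es x = .fvar x) ∧
      ∀ e ∈ es, Conv (circUnifier es e.1) (e.2.subst (circUnifier es)) := by
  induction es using List.reverseRecOn with
  | nil => exact ⟨fun _ => trivial, fun _ _ => rfl, by simp⟩
  | append_singleton es e ih =>
    have hstep : circUnifier (es ++ [e]) = circStep (circUnifier es) e := by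
      simp [circUnifier]
    rw [List.map_append, List.nodup_append] at hlin
    obtain ⟨hclosed, hid, hconv⟩ :=
      ih (fun e' he' => hsimple e' (List.mem_append_left _ he')) hlin.1
    have hfresh : e.1 ∉ es.map Prod.fst := fun h => hlin.2.2 e.1 h e.1 (by simp) rfl
    have ht : (e.2.subst (circUnifier es)).ClosedAt 0 :=
      ((hsimple e (by simp)).closedAt 0).subst hclosed
    rw [hstep]
    rcases circStep_cases (circUnifier es) e ht with ⟨hvar, heq⟩ | ⟨u, hu, heq, hsol⟩
    · rw [heq]
      refine ⟨hclosed, fun x hx => hid x fun h => hx ?_, fun e' he' => ?_⟩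
      · rw [List.map_append]
        exact List.mem_append_left _ h
      · rcases List.mem_append.1 he' with h | h
        · exact hconv e' h
        · rw [List.mem_singleton.1 h, hvar, hid _ hfresh]
          exact .refl _
    · rw [heq]
      refine ⟨fun x => (hclosed x).subst (closedAt_single hu e.1), fun x hx => ?_,
        fun e' he' => ?_⟩
      · rw [List.map_append, List.mem_append, not_or] at hx
        have hne : x ≠ e.1 := by simpa using hx.2
        simp [compS, hid x hx.1, GTm.subst, single, hne]
      · rw [GTm.subst_compS]
        rcases List.mem_append.1 he' with h | h
        · exact (hconv e' h).subst (closedAt_single hu e.1)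
        · rw [List.mem_singleton.1 h]
          simpa [compS, hid _ hfresh, GTm.subst, single] using hsol

/-- For a linear unifying list of equations `[(x₁,t₁),…,(xₙ,tₙ)]` over simple
first-order terms (at most one equation per variable), every stage
`δₖ = circUnifier (es.take k)` of the circular-unifier construction unifies the
first `k` equations up to convertibility: `xᵢ[δₖ] ≅ tᵢ[δₖ]` for all `i ≤ k`. -/
theorem circ_stage_unifies_prefix
    {F : Type} {ar : F → ℕ} (es : List (ℕ × GTm F ar))
    (hsimple : ∀ e ∈ es, GTm.Simple e.2)
    (hlin : (es.map Prod.fst).Nodup) :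
    ∀ k ≤ es.length, ∀ e ∈ es.take k,
      Conv (circUnifier (es.take k) e.1)
           (GTm.subst (circUnifier (es.take k)) e.2) := by
  intro k _
  refine (circUnifier_spec (es.take k)
    (fun e he => hsimple e (List.mem_of_mem_take he)) ?_).2.2
  exact hlin.sublist ((List.take_sublist k es).map Prod.fst)
end

section
/- For any two simple first-order terms M and N, the set of generalisations of M and N is filtered with respect to the order ≤: for all generalisations A and B of M and N, there exists a generalisation C of M and N such that A ≤ C and B ≤ C. -/
/-!
Simple first-order terms over a first-order signature `(F, ar)` (function
symbols `F` with arities `ar`): terms built from function symbols and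
variables only, with no `λ` and no `fix`; finitely supported substitutions;
the generalisation order `M ≤ N ⟺ ∃σ, M[σ] = N`.
-/

/-- Simple first-order terms over the signature `(F, ar)`. -/
inductive STm (F : Type) (ar : F → ℕ) : Type
  | var : ℕ → STm F ar
  | app : (f : F) → (Fin (ar f) → STm F ar) → STm F ar

namespace STm

variable {F : Type} {ar : F → ℕ}

/-- Apply a substitution (a map from variables to terms), homomorphically. -/
def subst (σ : ℕ → STm F ar) : STm F ar → STm F ar
  | var x => σ x
  | app f ts => app f fun i => subst σ (ts i)

/-- A substitution is finitely supported. -/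
def FinSupp (σ : ℕ → STm F ar) : Prop := {x : ℕ | σ x ≠ var x}.Finite

/-- The generalisation order: `M ≤ N` iff some (finitely supported)
substitution `σ` satisfies `M[σ] = N`. -/
def Le (M N : STm F ar) : Prop := ∃ σ : ℕ → STm F ar, FinSupp σ ∧ subst σ M = N

/-- `A` is a generalisation of `M` and `N` if `A ≤ M` and `A ≤ N`. -/
def IsGen (A M N : STm F ar) : Prop := Le A M ∧ Le A N

end STm

namespace STm

/-- The set of variables occurring in a term. -/
def vars {F : Type} {ar : F → ℕ} : STm F ar → Set ℕ
  | var x => {x}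
  | app _ ts => ⋃ i, vars (ts i)

/-- The set of subterms of a term. -/
def subterms {F : Type} {ar : F → ℕ} : STm F ar → Set (STm F ar)
  | var x => {var x}
  | app f ts => insert (app f ts) (⋃ i, subterms (ts i))

open Classical in
/-- Anti-unification of two terms, where `φ` names the pairs of disagreeing subterms. -/
noncomputable def antiUnify {F : Type} {ar : F → ℕ} (φ : STm F ar × STm F ar → ℕ) :
    STm F ar → STm F ar → STm F ar
  | var x, N => var (φ (var x, N))
  | app f ts, var y => var (φ (app f ts, var y))
  | app f ts, app g us =>
    if h : f = g then app f fun i => antiUnify φ (ts i) (us (Fin.cast (congrArg ar h) i))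
    else var (φ (app f ts, app g us))

theorem finite_vars {F : Type} {ar : F → ℕ} (A : STm F ar) : A.vars.Finite := by
  induction A with
  | var x => exact Set.finite_singleton x
  | app f ts ih => exact Set.finite_iUnion ih

theorem finite_subterms {F : Type} {ar : F → ℕ} (A : STm F ar) : A.subterms.Finite := by
  induction A with
  | var x => exact Set.finite_singleton _
  | app f ts ih => exact (Set.finite_iUnion ih).insert _

theorem self_mem_subterms {F : Type} {ar : F → ℕ} (A : STm F ar) : A ∈ A.subterms := by
  cases A <;> simp [subterms]

theorem subterms_subset_app {F : Type} {ar : F → ℕ} (f : F) (ts : Fin (ar f) → STm F ar)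
    (i : Fin (ar f)) : (ts i).subterms ⊆ (app f ts).subterms :=
  fun _ hP => Set.mem_insert_of_mem _ (Set.mem_iUnion_of_mem i hP)

theorem subst_congr {F : Type} {ar : F → ℕ} {σ τ : ℕ → STm F ar} (A : STm F ar)
    (h : ∀ x ∈ A.vars, σ x = τ x) : subst σ A = subst τ A := by
  induction A with
  | var x => exact h x rfl
  | app f ts ih =>
    simp only [subst]
    congr 1
    funext i
    exact ih i fun x hx => h x (Set.mem_iUnion_of_mem i hx)

/-- Finiteness of the support is no restriction in the generalisation order. -/
theorem le_subst {F : Type} {ar : F → ℕ} (σ : ℕ → STm F ar) (A : STm F ar) :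
    Le A (subst σ A) := by
  classical
  refine ⟨fun x => if x ∈ A.vars then σ x else var x, ?_, ?_⟩
  · refine A.finite_vars.subset fun x hx => ?_
    by_contra hn
    exact hx (if_neg hn)
  · exact subst_congr A fun x hx => if_pos hx

theorem subst_antiUnify {F : Type} {ar : F → ℕ} (φ : STm F ar × STm F ar → ℕ)
    (σ τ : ℕ → STm F ar) (A : STm F ar) :
    subst (fun x => antiUnify φ (σ x) (τ x)) A = antiUnify φ (subst σ A) (subst τ A) := by
  induction A with
  | var x => rfl
  | app f ts ih => simp [subst, antiUnify, ih]

theorem subst_antiUnify_left {F : Type} {ar : F → ℕ} (φ : STm F ar × STm F ar → ℕ)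
    (π : ℕ → STm F ar) (M N : STm F ar)
    (h : ∀ P ∈ M.subterms, ∀ Q ∈ N.subterms, π (φ (P, Q)) = P) :
    subst π (antiUnify φ M N) = M := by
  induction M generalizing N with
  | var x => exact h _ (self_mem_subterms _) _ (self_mem_subterms _)
  | app f ts ih =>
    cases N with
    | var y => exact h _ (self_mem_subterms _) _ (self_mem_subterms _)
    | app g us =>
      by_cases hfg : f = g
      · subst hfg
        simp only [antiUnify, dite_true, subst]
        congr 1
        funext i
        exact ih i _ fun P hP Q hQ =>
          h P (subterms_subset_app f ts i hP) Q (subterms_subset_app f us i hQ)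
      · simpa only [antiUnify, dif_neg hfg, subst] using
          h _ (self_mem_subterms _) _ (self_mem_subterms _)

theorem subst_antiUnify_right {F : Type} {ar : F → ℕ} (φ : STm F ar × STm F ar → ℕ)
    (π : ℕ → STm F ar) (M N : STm F ar)
    (h : ∀ P ∈ M.subterms, ∀ Q ∈ N.subterms, π (φ (P, Q)) = Q) :
    subst π (antiUnify φ M N) = N := by
  induction M generalizing N with
  | var x => exact h _ (self_mem_subterms _) _ (self_mem_subterms _)
  | app f ts ih =>
    cases N with
    | var y => exact h _ (self_mem_subterms _) _ (self_mem_subterms _)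
    | app g us =>
      by_cases hfg : f = g
      · subst hfg
        simp only [antiUnify, dite_true, subst]
        congr 1
        funext i
        exact ih i _ fun P hP Q hQ =>
          h P (subterms_subset_app f ts i hP) Q (subterms_subset_app f us i hQ)
      · simpa only [antiUnify, dif_neg hfg, subst] using
          h _ (self_mem_subterms _) _ (self_mem_subterms _)

/-- Every generalisation of `M` and `N` lies below their anti-unification. -/
theorem IsGen.le_antiUnify {F : Type} {ar : F → ℕ} {A M N : STm F ar} (hA : IsGen A M N)
    (φ : STm F ar × STm F ar → ℕ) : Le A (antiUnify φ M N) := by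
  obtain ⟨⟨σ, -, rfl⟩, ⟨τ, -, rfl⟩⟩ := hA
  rw [← subst_antiUnify]
  exact le_subst _ A

theorem isGen_antiUnify {F : Type} {ar : F → ℕ} {M N : STm F ar}
    {φ : STm F ar × STm F ar → ℕ} (hφ : Set.InjOn φ (M.subterms ×ˢ N.subterms)) :
    IsGen (antiUnify φ M N) M N := by
  have : Nonempty (STm F ar × STm F ar) := ⟨(M, N)⟩
  have inv : ∀ P ∈ M.subterms, ∀ Q ∈ N.subterms,
      Function.invFunOn φ (M.subterms ×ˢ N.subterms) (φ (P, Q)) = (P, Q) :=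
    fun P hP Q hQ => hφ.leftInvOn_invFunOn (Set.mk_mem_prod hP hQ)
  have hM := subst_antiUnify_left φ
    (fun n => (Function.invFunOn φ (M.subterms ×ˢ N.subterms) n).1) M N
    fun P hP Q hQ => congrArg Prod.fst (inv P hP Q hQ)
  have hN := subst_antiUnify_right φ
    (fun n => (Function.invFunOn φ (M.subterms ×ˢ N.subterms) n).2) M N
    fun P hP Q hQ => congrArg Prod.snd (inv P hP Q hQ)
  have leM := le_subst (fun n => (Function.invFunOn φ (M.subterms ×ˢ N.subterms) n).1)
    (antiUnify φ M N)
  have leN := le_subst (fun n => (Function.invFunOn φ (M.subterms ×ˢ N.subterms) n).2)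
    (antiUnify φ M N)
  rw [hM] at leM
  rw [hN] at leN
  exact ⟨leM, leN⟩

end STm

/-- For any two simple first-order terms `M` and `N`, the set of
generalisations of `M` and `N` is filtered with respect to `≤`: for all
generalisations `A` and `B` of `M` and `N` there is a generalisation `C` of
`M` and `N` with `A ≤ C` and `B ≤ C`. -/
theorem generalisations_filtered {F : Type} {ar : F → ℕ}
    (M N A B : STm F ar) (hA : STm.IsGen A M N) (hB : STm.IsGen B M N) :
    ∃ C : STm F ar, STm.IsGen C M N ∧ STm.Le A C ∧ STm.Le B C := by
  obtain ⟨φ, hφ⟩ := Set.countable_iff_exists_injOn.mp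
    (M.finite_subterms.prod N.finite_subterms).countable
  exact ⟨STm.antiUnify φ M N, STm.isGen_antiUnify hφ, hA.le_antiUnify φ, hB.le_antiUnify φ⟩
end
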